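/- Let 1/2 < s ≤ 1, θ₀ > 1/2, and M ≥ 2. Then there exists a constant C > 0 such that for all Schwartz functions u, v on ℝ^{1+2}, ‖uv‖_{H^{−M, 0}} ≤ C ‖u‖_{H^{s−1/2, θ₀}} ‖v‖_{H^{s−1/2, θ₀}}. -/

import Mathlib

open MeasureTheory Real
open scoped FourierTransform

noncomputable section

/-- Space-time ℝ^{1+2}: coordinate 0 is time `t`, coordinates 1,2 are space `x`. -/
abbrev SpaceTime := EuclideanSpace ℝ (Fin 3)

/-- The magnitude `|ξ|` of the spatial part of a frequency point `(τ, ξ) ∈ ℝ × ℝ²`. -/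
def spFreq (ζ : SpaceTime) : ℝ := Real.sqrt ((ζ 1) ^ 2 + (ζ 2) ^ 2)

/-- The wave-Sobolev norm
`‖u‖_{H^{s,b}} = (∫ (1+|ξ|²)^s (1+||τ|-|ξ||)^{2b} |û(τ,ξ)|² dτ dξ)^{1/2}`. -/
def waveNorm (s b : ℝ) (f : SpaceTime → ℂ) : ℝ :=
  (∫ ζ : SpaceTime, (1 + (spFreq ζ) ^ 2) ^ s * (1 + |(|ζ 0| - spFreq ζ)|) ^ (2 * b) *
    ‖𝓕 f ζ‖ ^ 2) ^ (1/2 : ℝ)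

open scoped ENNReal

/-- The Fourier transform of a product of Schwartz functions, as a convolution. -/
theorem fourier_mul_schwartz_apply (u v : SchwartzMap SpaceTime ℂ) (ζ : SpaceTime) :
    𝓕 (fun x => u x * v x) ζ = ∫ t, 𝓕 (⇑u) t * 𝓕 (⇑v) (ζ - t) := by
  let B := ContinuousLinearMap.mul ℂ ℂ
  have h₁ : (fun x => u x * v x) =
      ⇑(𝓕 (SchwartzMap.convolution B (𝓕⁻ u) (𝓕⁻ v)) : SchwartzMap SpaceTime ℂ) := by
    rw [SchwartzMap.fourier_convolution]
    ext x
    simp [B]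
  have h₂ : 𝓕 (fun x => u x * v x) ζ = SchwartzMap.convolution B (𝓕⁻ u) (𝓕⁻ v) (-ζ) := by
    rw [h₁, ← neg_neg ζ, ← Real.fourierInv_eq_fourier_neg, ← SchwartzMap.fourierInv_coe]
    simp
  rw [h₂, SchwartzMap.convolution_apply, convolution, ← integral_neg_eq_self]
  refine integral_congr_ae (.of_forall fun t => ?_)
  simp only [B, ContinuousLinearMap.mul_apply', SchwartzMap.fourierInv_coe,
    Real.fourierInv_eq_fourier_neg, neg_neg]
  rw [show -(-ζ - -t) = ζ - t by abel]

/-- The Fourier transform of a product of Schwartz functions is continuous. -/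
theorem continuous_fourier_mul_schwartz (u v : SchwartzMap SpaceTime ℂ) :
    Continuous (𝓕 (fun x => u x * v x)) := by
  have h : (fun x => u x * v x) =
      ⇑(SchwartzMap.pairing (ContinuousLinearMap.mul ℂ ℂ) u v) := by
    ext x
    simp
  rw [h, ← SchwartzMap.fourier_coe]
  exact SchwartzMap.continuous _

/-- Cauchy–Schwarz for `lintegral`. -/
theorem sq_lintegral_mul_le {α : Type*} [MeasurableSpace α] (μ : Measure α) {f g : α → ℝ≥0∞}
    (hf : AEMeasurable f μ) (hg : AEMeasurable g μ) :
    (∫⁻ a, f a * g a ∂μ) ^ 2 ≤ (∫⁻ a, f a ^ 2 ∂μ) * ∫⁻ a, g a ^ 2 ∂μ := by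
  have h := ENNReal.lintegral_mul_le_Lp_mul_Lq μ Real.HolderConjugate.two_two hf hg
  calc _ ≤ ((∫⁻ a, f a ^ (2 : ℝ) ∂μ) ^ (1 / 2 : ℝ) * (∫⁻ a, g a ^ (2 : ℝ) ∂μ) ^ (1 / 2 : ℝ)) ^ 2 := by
        gcongr
        exact h
    _ = _ := by
        rw [mul_pow, ← ENNReal.rpow_natCast, ← ENNReal.rpow_natCast, ← ENNReal.rpow_mul,
          ← ENNReal.rpow_mul]
        norm_num

/-- A weighted `L²` convolution bound from a Schur-type condition on the weights. -/
theorem lintegral_weight_mul_sq_convolution_le {E : Type*} [AddCommGroup E] [MeasurableSpace E]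
    [MeasurableAdd₂ E] [MeasurableNeg E] (μ : Measure E) [SFinite μ] [μ.IsAddRightInvariant]
    {A W F G P : E → ℝ≥0∞} (hA : Measurable A) (hW : Measurable W) (hF : Measurable F)
    (hG : Measurable G) (hW0 : ∀ t, W t ≠ 0) (hWtop : ∀ t, W t ≠ ∞) {C : ℝ≥0∞}
    (hC : ∀ η, ∫⁻ t, A (η + t) * (W t ^ 2)⁻¹ ∂μ ≤ C)
    (hP : ∀ ζ, P ζ ≤ ∫⁻ t, F t * G (ζ - t) ∂μ) :
    ∫⁻ ζ, A ζ * P ζ ^ 2 ∂μ ≤ C * (∫⁻ t, (W t * F t) ^ 2 ∂μ) * ∫⁻ t, G t ^ 2 ∂μ := by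
  have hpt : ∀ ζ, P ζ ^ 2 ≤
      (∫⁻ t, (W t * F t) ^ 2 ∂μ) * ∫⁻ t, ((W t)⁻¹ * G (ζ - t)) ^ 2 ∂μ := by
    intro ζ
    calc P ζ ^ 2 ≤ (∫⁻ t, (W t * F t) * ((W t)⁻¹ * G (ζ - t)) ∂μ) ^ 2 := by
          gcongr
          refine (hP ζ).trans (le_of_eq (lintegral_congr fun t => ?_))
          calc F t * G (ζ - t) = (W t * (W t)⁻¹) * (F t * G (ζ - t)) := by
                rw [ENNReal.mul_inv_cancel (hW0 t) (hWtop t), one_mul]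
            _ = _ := by ring
      _ ≤ _ := sq_lintegral_mul_le μ (by fun_prop) (by fun_prop)
  calc ∫⁻ ζ, A ζ * P ζ ^ 2 ∂μ
      ≤ ∫⁻ ζ, (∫⁻ t, (W t * F t) ^ 2 ∂μ) *
          ∫⁻ t, A ζ * ((W t)⁻¹ * G (ζ - t)) ^ 2 ∂μ ∂μ := by
        refine lintegral_mono fun ζ => ?_
        rw [lintegral_const_mul _ (by fun_prop), mul_left_comm]
        gcongr
        exact hpt ζ
    _ = (∫⁻ t, (W t * F t) ^ 2 ∂μ) *
          ∫⁻ ζ, ∫⁻ t, A ζ * ((W t)⁻¹ * G (ζ - t)) ^ 2 ∂μ ∂μ :=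
        lintegral_const_mul _ (Measurable.lintegral_prod_right' (f := fun p : E × E =>
          A p.1 * ((W p.2)⁻¹ * G (p.1 - p.2)) ^ 2) (by fun_prop))
    _ = (∫⁻ t, (W t * F t) ^ 2 ∂μ) *
          ∫⁻ t, ∫⁻ η, A (η + t) * (W t ^ 2)⁻¹ * G η ^ 2 ∂μ ∂μ := by
        congr 1
        rw [lintegral_lintegral_swap (by fun_prop)]
        refine lintegral_congr fun t => ?_
        rw [← lintegral_add_right_eq_self _ t]
        refine lintegral_congr fun η => ?_
        rw [add_sub_cancel_right, mul_pow, ENNReal.inv_pow, mul_assoc]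
    _ = (∫⁻ t, (W t * F t) ^ 2 ∂μ) *
          ∫⁻ η, (∫⁻ t, A (η + t) * (W t ^ 2)⁻¹ ∂μ) * G η ^ 2 ∂μ := by
        congr 1
        rw [lintegral_lintegral_swap (by fun_prop)]
        refine lintegral_congr fun η => ?_
        rw [lintegral_mul_const _ (by fun_prop)]
    _ ≤ (∫⁻ t, (W t * F t) ^ 2 ∂μ) * ∫⁻ η, C * G η ^ 2 ∂μ := by
        gcongr with η
        exact hC η
    _ = _ := by
        rw [lintegral_const_mul _ (by fun_prop)]
        ring

/-- The coordinate map `SpaceTime → ℝ × ℝ × ℝ` preserves volume. -/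
theorem measurePreserving_spaceTime_coords :
    MeasurePreserving (fun ζ : SpaceTime => (ζ 0, ζ 1, ζ 2)) := by
  have h₁ := PiLp.volume_preserving_ofLp (Fin 3)
  have h₂ := volume_preserving_piFinSuccAbove (fun _ : Fin 3 => ℝ) 0
  have h₃ := (MeasurePreserving.id (volume : Measure ℝ)).prod (volume_preserving_finTwoArrow ℝ)
  exact (h₃.comp h₂).comp h₁

/-- Tonelli in the coordinates of `SpaceTime`, integrating in time first. -/
theorem lintegral_spaceTime_coords {f : ℝ × ℝ × ℝ → ℝ≥0∞} (hf : Measurable f) :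
    ∫⁻ ζ : SpaceTime, f (ζ 0, ζ 1, ζ 2) = ∫⁻ b, ∫⁻ c, ∫⁻ a, f (a, b, c) := by
  rw [measurePreserving_spaceTime_coords.lintegral_comp hf, Measure.volume_eq_prod,
    lintegral_prod_symm' _ hf, Measure.volume_eq_prod,
    lintegral_prod _ (Measurable.lintegral_prod_left' hf).aemeasurable]

/-- Integrability in time of the modulation weight, uniformly in the spatial frequency. -/
theorem lintegral_modulation_weight_le (b r : ℝ) :
    ∫⁻ τ : ℝ, ENNReal.ofReal ((1 + |(|τ| - r)|) ^ (-b)) ≤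
      2 * ∫⁻ τ : ℝ, ENNReal.ofReal ((1 + ‖τ‖) ^ (-b)) := by
  let q : ℝ → ℝ≥0∞ := fun τ => ENNReal.ofReal ((1 + ‖τ‖) ^ (-b))
  have hq : Measurable q := by fun_prop
  calc ∫⁻ τ : ℝ, ENNReal.ofReal ((1 + |(|τ| - r)|) ^ (-b))
      ≤ ∫⁻ τ : ℝ, (q (τ - r) + q (τ + r)) := by
        refine lintegral_mono fun τ => ?_
        rcases abs_choice τ with h | h
        · rw [h]
          exact le_self_add
        · rw [h, show -τ - r = -(τ + r) by ring, abs_neg]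
          exact le_add_self
    _ = _ := by
        rw [lintegral_add_left (by fun_prop), lintegral_sub_right_eq_self q r,
          lintegral_add_right_eq_self q r, two_mul]

/-- The spatial weight is dominated by a product of one-dimensional integrable weights. -/
theorem one_add_sq_add_sq_rpow_neg_le {M : ℝ} (hM : 2 ≤ M) (a b : ℝ) :
    (1 + (a ^ 2 + b ^ 2)) ^ (-M) ≤ (1 + a ^ 2)⁻¹ * (1 + b ^ 2)⁻¹ := by
  have h : (1 + (a ^ 2 + b ^ 2)) ^ (-M) ≤ (1 + (a ^ 2 + b ^ 2)) ^ (-2 : ℝ) :=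
    Real.rpow_le_rpow_of_exponent_le (by nlinarith [sq_nonneg a, sq_nonneg b]) (by linarith)
  refine h.trans ?_
  rw [Real.rpow_neg (by positivity), Real.rpow_two, ← mul_inv]
  gcongr
  nlinarith [sq_nonneg a, sq_nonneg b, mul_nonneg (sq_nonneg a) (sq_nonneg b)]

theorem measurable_spFreq : Measurable spFreq := by
  unfold spFreq
  fun_prop

/-- The Schur-type kernel condition for the weights in the product estimate. -/
theorem lintegral_kernel_le {M : ℝ} (hM : 2 ≤ M) (b : ℝ) (η : SpaceTime) :
    ∫⁻ t : SpaceTime, ENNReal.ofReal ((1 + spFreq (η + t) ^ 2) ^ (-M)) *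
        ENNReal.ofReal ((1 + |(|t 0| - spFreq t)|) ^ (-b)) ≤
      (∫⁻ x : ℝ, ENNReal.ofReal (1 + x ^ 2)⁻¹) ^ 2 *
        (2 * ∫⁻ τ : ℝ, ENNReal.ofReal ((1 + ‖τ‖) ^ (-b))) := by
  let p : ℝ → ℝ≥0∞ := fun x => ENNReal.ofReal (1 + x ^ 2)⁻¹
  have hp : Measurable p := by fun_prop
  let φ : ℝ × ℝ × ℝ → ℝ≥0∞ := fun z => (p (η 1 + z.2.1) * p (η 2 + z.2.2)) *
    ENNReal.ofReal ((1 + |(|z.1| - √(z.2.1 ^ 2 + z.2.2 ^ 2))|) ^ (-b))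
  have hφ : Measurable φ := by fun_prop
  set J := 2 * ∫⁻ τ : ℝ, ENNReal.ofReal ((1 + ‖τ‖) ^ (-b))
  calc _ ≤ ∫⁻ t : SpaceTime, φ (t 0, t 1, t 2) := by
        refine lintegral_mono fun t => ?_
        dsimp only [φ, p, spFreq]
        refine mul_le_mul_left ?_ _
        rw [← ENNReal.ofReal_mul (by positivity), Real.sq_sqrt (by positivity)]
        refine ENNReal.ofReal_le_ofReal ?_
        exact one_add_sq_add_sq_rpow_neg_le hM _ _
    _ = ∫⁻ x, ∫⁻ y, ∫⁻ τ, φ (τ, x, y) := lintegral_spaceTime_coords hφ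
    _ ≤ ∫⁻ x, ∫⁻ y, p (η 1 + x) * (p (η 2 + y) * J) := by
        refine lintegral_mono fun x => lintegral_mono fun y => ?_
        dsimp only [φ]
        rw [lintegral_const_mul _ (by fun_prop), ← mul_assoc]
        gcongr
        exact lintegral_modulation_weight_le b _
    _ = _ := by
        have h (x : ℝ) : ∫⁻ y, p (η 1 + x) * (p (η 2 + y) * J) =
            p (η 1 + x) * ((∫⁻ y, p y) * J) := by
          rw [lintegral_const_mul _ (by fun_prop), lintegral_mul_const _ (by fun_prop),
            lintegral_add_left_eq_self p]
        simp_rw [h]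
        rw [lintegral_mul_const _ (by fun_prop), lintegral_add_left_eq_self p, sq, mul_assoc]

theorem lintegral_kernel_const_lt_top {b : ℝ} (hb : 1 < b) :
    (∫⁻ x : ℝ, ENNReal.ofReal (1 + x ^ 2)⁻¹) ^ 2 *
        (2 * ∫⁻ τ : ℝ, ENNReal.ofReal ((1 + ‖τ‖) ^ (-b))) < ∞ := by
  have h₁ : Integrable fun τ : ℝ => (1 + ‖τ‖) ^ (-b) :=
    integrable_one_add_norm (by simpa using hb)
  exact ENNReal.mul_lt_top (ENNReal.pow_lt_top integrable_inv_one_add_sq.lintegral_lt_top)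
    (ENNReal.mul_lt_top (by simp) h₁.lintegral_lt_top)

theorem spFreq_le_norm (ζ : SpaceTime) : spFreq ζ ≤ ‖ζ‖ := by
  rw [spFreq, EuclideanSpace.norm_eq]
  refine Real.sqrt_le_sqrt ?_
  simp only [Fin.sum_univ_three, Real.norm_eq_abs, sq_abs]
  nlinarith [sq_nonneg (ζ 0)]

/-- The weighted `L²` density in the definition of `waveNorm` is integrable for Schwartz `u`. -/
theorem integrable_waveNorm_density {s b : ℝ} (hs : 0 ≤ s) (hb : 0 ≤ b)
    (u : SchwartzMap SpaceTime ℂ) :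
    Integrable fun ζ : SpaceTime => (1 + spFreq ζ ^ 2) ^ s *
      (1 + |(|ζ 0| - spFreq ζ)|) ^ (2 * b) * ‖𝓕 (⇑u) ζ‖ ^ 2 := by
  rw [← SchwartzMap.fourier_coe]
  set f : SchwartzMap SpaceTime ℂ := 𝓕 u
  obtain ⟨n, hn⟩ := exists_nat_ge (2 * s + 2 * b)
  obtain ⟨K, hK⟩ : ∃ K, ∀ x, ‖f x‖ ≤ K :=
    ⟨_, fun x => SchwartzMap.norm_le_seminorm ℝ f x⟩
  have hK0 : 0 ≤ K := (norm_nonneg _).trans (hK 0)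
  have hdom : Integrable fun ζ : SpaceTime =>
      (2 ^ (n - 1) * K) * (‖ζ‖ ^ 0 * ‖f ζ‖ + ‖ζ‖ ^ n * ‖f ζ‖) :=
    ((f.integrable_pow_mul volume 0).add (f.integrable_pow_mul volume n)).const_mul _
  refine hdom.mono' ?_ (.of_forall fun ζ => ?_)
  · have := measurable_spFreq
    have := f.continuous.measurable
    exact Measurable.aestronglyMeasurable (by fun_prop)
  · have hr0 : 0 ≤ spFreq ζ := Real.sqrt_nonneg _
    have hr := spFreq_le_norm ζ
    have h0 : |ζ 0| ≤ ‖ζ‖ := by simpa using PiLp.norm_apply_le ζ 0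
    have hm : |(|ζ 0| - spFreq ζ)| ≤ ‖ζ‖ :=
      abs_le.2 ⟨by linarith [abs_nonneg (ζ 0)], by linarith⟩
    rw [Real.norm_of_nonneg (by positivity)]
    have h₁ : (1 + spFreq ζ ^ 2) ^ s ≤ (1 + ‖ζ‖) ^ (2 * s) := by
      rw [Real.rpow_mul (by positivity), Real.rpow_two]
      gcongr
      nlinarith
    have h₂ : (1 + |(|ζ 0| - spFreq ζ)|) ^ (2 * b) ≤ (1 + ‖ζ‖) ^ (2 * b) := by gcongr
    have h₃ : (1 + ‖ζ‖) ^ (2 * s) * (1 + ‖ζ‖) ^ (2 * b) ≤ (1 + ‖ζ‖) ^ n := by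
      rw [← Real.rpow_add (by positivity), ← Real.rpow_natCast]
      exact Real.rpow_le_rpow_of_exponent_le (by linarith [norm_nonneg ζ]) hn
    calc _ ≤ ((1 + ‖ζ‖) ^ (2 * s) * (1 + ‖ζ‖) ^ (2 * b)) * (K * ‖f ζ‖) := by
          rw [sq ‖f ζ‖]
          gcongr
          exact hK ζ
      _ ≤ (2 ^ (n - 1) * (1 ^ n + ‖ζ‖ ^ n)) * (K * ‖f ζ‖) := by
          refine mul_le_mul_of_nonneg_right ?_ (by positivity)
          exact h₃.trans (add_pow_le zero_le_one (norm_nonneg ζ) n)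
      _ = _ := by
          rw [one_pow, pow_zero]
          ring

/-- `waveNorm` of a Schwartz function, squared, as a lower Lebesgue integral. -/
theorem ofReal_waveNorm_sq {s b : ℝ} (hs : 0 ≤ s) (hb : 0 ≤ b) (u : SchwartzMap SpaceTime ℂ) :
    ENNReal.ofReal (waveNorm s b u ^ 2) = ∫⁻ ζ : SpaceTime, ENNReal.ofReal
      ((1 + spFreq ζ ^ 2) ^ s * (1 + |(|ζ 0| - spFreq ζ)|) ^ (2 * b) * ‖𝓕 (⇑u) ζ‖ ^ 2) := by
  have h0 (ζ : SpaceTime) : 0 ≤ (1 + spFreq ζ ^ 2) ^ s *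
      (1 + |(|ζ 0| - spFreq ζ)|) ^ (2 * b) * ‖𝓕 (⇑u) ζ‖ ^ 2 := by positivity
  rw [waveNorm, ← Real.sqrt_eq_rpow, Real.sq_sqrt (integral_nonneg h0),
    ofReal_integral_eq_lintegral_ofReal (integrable_waveNorm_density hs hb u) (.of_forall h0)]

theorem waveNorm_nonneg (s b : ℝ) (f : SpaceTime → ℂ) : 0 ≤ waveNorm s b f :=
  Real.rpow_nonneg (integral_nonneg fun ζ => by positivity) _

/-- The squared product estimate, in `ℝ≥0∞`. -/
theorem lintegral_mul_density_le {s b M : ℝ} (hs : 0 ≤ s) (hb : 0 ≤ b) (hM : 2 ≤ M)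
    (u v : SchwartzMap SpaceTime ℂ) :
    ∫⁻ ζ : SpaceTime, ENNReal.ofReal ((1 + spFreq ζ ^ 2) ^ (-M)) *
        ‖𝓕 (fun x => u x * v x) ζ‖ₑ ^ 2 ≤
      ((∫⁻ x : ℝ, ENNReal.ofReal (1 + x ^ 2)⁻¹) ^ 2 *
        (2 * ∫⁻ τ : ℝ, ENNReal.ofReal ((1 + ‖τ‖) ^ (-(2 * b))))) *
        ENNReal.ofReal (waveNorm s b u ^ 2) * ENNReal.ofReal (waveNorm s b v ^ 2) := by
  let W : SpaceTime → ℝ≥0∞ := fun t => ENNReal.ofReal ((1 + |(|t 0| - spFreq t)|) ^ b)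
  have hsp := measurable_spFreq
  have hu : Measurable (𝓕 (⇑u)) := by
    rw [← SchwartzMap.fourier_coe]
    exact SchwartzMap.continuous _ |>.measurable
  have hv : Measurable (𝓕 (⇑v)) := by
    rw [← SchwartzMap.fourier_coe]
    exact SchwartzMap.continuous _ |>.measurable
  have hW2 (t : SpaceTime) : W t ^ 2 =
      ENNReal.ofReal ((1 + |(|t 0| - spFreq t)|) ^ (2 * b)) := by
    rw [← ENNReal.ofReal_pow (by positivity), ← Real.rpow_mul_natCast (by positivity),
      mul_comm b, Nat.cast_ofNat]
  have h1 (t : SpaceTime) : 1 ≤ (1 + spFreq t ^ 2) ^ s :=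
    Real.one_le_rpow (by nlinarith [sq_nonneg (spFreq t)]) hs
  have h2 (t : SpaceTime) : 1 ≤ (1 + |(|t 0| - spFreq t)|) ^ (2 * b) :=
    Real.one_le_rpow (by linarith [abs_nonneg (|t 0| - spFreq t)]) (by positivity)
  have key := lintegral_weight_mul_sq_convolution_le (volume : Measure SpaceTime)
    (A := fun ζ => ENNReal.ofReal ((1 + spFreq ζ ^ 2) ^ (-M))) (W := W)
    (F := fun ζ => ‖𝓕 (⇑u) ζ‖ₑ) (G := fun ζ => ‖𝓕 (⇑v) ζ‖ₑ)
    (P := fun ζ => ‖𝓕 (fun x => u x * v x) ζ‖ₑ)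
    (by fun_prop) (by fun_prop) (by fun_prop) (by fun_prop)
    (fun t => (ENNReal.ofReal_pos.2 (by positivity)).ne') (fun t => ENNReal.ofReal_ne_top)
    (C := (∫⁻ x : ℝ, ENNReal.ofReal (1 + x ^ 2)⁻¹) ^ 2 *
        (2 * ∫⁻ τ : ℝ, ENNReal.ofReal ((1 + ‖τ‖) ^ (-(2 * b)))))
    (fun η => by
      refine le_trans (le_of_eq (lintegral_congr fun t => ?_)) (lintegral_kernel_le hM (2 * b) η)
      rw [hW2, ← ENNReal.ofReal_inv_of_pos (by positivity), ← Real.rpow_neg (by positivity)])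
    (fun ζ => by
      rw [fourier_mul_schwartz_apply]
      exact (enorm_integral_le_lintegral_enorm _).trans_eq (by simp_rw [enorm_mul]))
  refine key.trans ?_
  rw [ofReal_waveNorm_sq hs hb, ofReal_waveNorm_sq hs hb]
  gcongr with t t
  · rw [mul_pow, hW2, ← ofReal_norm, ← ENNReal.ofReal_pow (by positivity),
      ← ENNReal.ofReal_mul (by positivity)]
    gcongr
    exact le_mul_of_one_le_left (by positivity) (h1 t)
  · rw [← ofReal_norm, ← ENNReal.ofReal_pow (by positivity)]
    gcongr
    exact le_mul_of_one_le_left (by positivity) (one_le_mul_of_one_le_of_one_le (h1 t) (h2 t))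

theorem low_frequency_product_estimate (s θ₀ M : ℝ)
    (hs : 1/2 < s) (hs1 : s ≤ 1) (hθ0 : θ₀ > 1/2) (hM : M ≥ 2) :
    ∃ C > 0, ∀ u v : SchwartzMap SpaceTime ℂ,
      waveNorm (-M) 0 (fun x => u x * v x) ≤
        C * waveNorm (s - 1/2) θ₀ (fun x => u x) * waveNorm (s - 1/2) θ₀ (fun x => v x) := by
  have hb : 1 < 2 * θ₀ := by linarith
  set K : ℝ≥0∞ := (∫⁻ x : ℝ, ENNReal.ofReal (1 + x ^ 2)⁻¹) ^ 2 *
    (2 * ∫⁻ τ : ℝ, ENNReal.ofReal ((1 + ‖τ‖) ^ (-(2 * θ₀)))) with hK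
  have hKtop : K ≠ ∞ := (lintegral_kernel_const_lt_top hb).ne
  refine ⟨√K.toReal + 1, by positivity, fun u v => ?_⟩
  have hu := waveNorm_nonneg (s - 1/2) θ₀ u
  have hv := waveNorm_nonneg (s - 1/2) θ₀ v
  have hmeas : Measurable (𝓕 (fun x => u x * v x)) := (continuous_fourier_mul_schwartz u v).measurable
  have hsp := measurable_spFreq
  have key : waveNorm (-M) 0 (fun x => u x * v x) ≤
      √K.toReal * (waveNorm (s - 1/2) θ₀ u * waveNorm (s - 1/2) θ₀ v) := by
    rw [waveNorm, ← Real.sqrt_eq_rpow, Real.sqrt_le_iff]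
    refine ⟨by positivity, ?_⟩
    rw [integral_eq_lintegral_of_nonneg_ae (.of_forall fun ζ => by positivity)
      (Measurable.aestronglyMeasurable (by fun_prop))]
    refine ENNReal.toReal_le_of_le_ofReal (by positivity) ?_
    calc _ = ∫⁻ ζ : SpaceTime, ENNReal.ofReal ((1 + spFreq ζ ^ 2) ^ (-M)) *
            ‖𝓕 (fun x => u x * v x) ζ‖ₑ ^ 2 := by
          refine lintegral_congr fun ζ => ?_
          rw [mul_zero, Real.rpow_zero, mul_one, ENNReal.ofReal_mul (by positivity),
            ENNReal.ofReal_pow (norm_nonneg _), ofReal_norm]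
      _ ≤ _ := lintegral_mul_density_le (s := s - 1/2) (b := θ₀) (by linarith) (by linarith) hM u v
      _ = _ := by
          rw [← hK, mul_pow, mul_pow, Real.sq_sqrt ENNReal.toReal_nonneg,
            ENNReal.ofReal_mul ENNReal.toReal_nonneg, ENNReal.ofReal_toReal hKtop,
            ENNReal.ofReal_mul (by positivity), mul_assoc]
  refine key.trans ?_
  rw [mul_assoc]
  gcongr
  linarith

end
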